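/- Assume (A.1) and fix π̂ ∈ S. For each α ∈ (0,1) let v_α : S × Γ → ℝ be a bounded solution of the discounted Bellman equation, and define λ_α^{(n)} := v_α(π̂, γ e^{-αn}) − v_α(π̂, γ e^{-α(n+1)}) for n ∈ ℕ. Then sup_{α ∈ (0,1)} sup_{n ∈ ℕ} |λ_α^{(n)}| < ∞; in particular |λ_α^{(n)}| ≤ |γ| · ( |ln s̃| + max(|z^-|, |z^+|) ) for all α ∈ (0,1) and n ∈ ℕ. -/

import Mathlib

open MeasureTheory Set

noncomputable section

/-- Standard scalar product on `ℝ^d`. -/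
def ip {d : ℕ} (x y : Fin d → ℝ) : ℝ := ∑ i, x i * y i

/-- `G(x,y) = (x·y)/⟨x,y⟩` (componentwise product, normalised). -/
def Gmap {d : ℕ} (x y : Fin d → ℝ) : Fin d → ℝ := fun i => x i * y i / ip x y

/-- Entropic utility `μ^γ(X) = (1/γ) ln E[e^{γX}]`. -/
def entropic {Ω : Type*} [MeasurableSpace Ω] (γ : ℝ) (P : Measure Ω) (X : Ω → ℝ) : ℝ :=
  (1 / γ) * Real.log (∫ ω, Real.exp (γ * X ω) ∂P)

/-- The parameter set `Γ = [min(γ,0), max(γ,0)] \ {0}`. -/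
def Gam (γ : ℝ) : Set ℝ := Icc (min γ 0) (max γ 0) \ {0}

/-- The discounted Bellman operator
`(Tv)(π,δ) = δ ⨆_{π' ∈ S} μ^δ(ln⟨π',w⟩ + ln s(π,π') + δ⁻¹ v(G(π',w), δe^{-α}))`. -/
def TOp {d : ℕ} {Ω : Type*} [MeasurableSpace Ω] (P : Measure Ω)
    (s : (Fin d → ℝ) → (Fin d → ℝ) → ℝ) (r : Ω → Fin d → ℝ) (α : ℝ)
    (v : (Fin d → ℝ) → ℝ → ℝ) : (Fin d → ℝ) → ℝ → ℝ :=
  fun π δ => δ * sSup ((fun π' => entropic δ P (fun ω =>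
      Real.log (ip π' (fun i => Real.exp (r ω i))) + Real.log (s π π') +
        δ⁻¹ * v (Gmap π' (fun i => Real.exp (r ω i))) (δ * Real.exp (-α)))) ''
      stdSimplex ℝ (Fin d))

/-- Supremum norm over `S × Γ`. -/
def supNormSG {d : ℕ} (γ : ℝ) (f : (Fin d → ℝ) → ℝ → ℝ) : ℝ :=
  sSup {y | ∃ π ∈ stdSimplex ℝ (Fin d), ∃ δ ∈ Gam γ, y = |f π δ|}

/-- Suprema of two families that are uniformly `ε`-close are `ε`-close (also when one of them,
hence both, is unbounded and the supremum takes its default value). -/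
theorem abs_sSup_image_sub_sSup_image_le {ι : Type*} {S : Set ι} {f g : ι → ℝ} {ε : ℝ}
    (hε : 0 ≤ ε) (h : ∀ x ∈ S, |f x - g x| ≤ ε) :
    |sSup (f '' S) - sSup (g '' S)| ≤ ε := by
  rcases S.eq_empty_or_nonempty with rfl | hS
  · simpa using hε
  have key : ∀ f g : ι → ℝ, (∀ x ∈ S, |f x - g x| ≤ ε) → BddAbove (g '' S) →
      BddAbove (f '' S) ∧ sSup (f '' S) ≤ sSup (g '' S) + ε := by
    intro f g h hg
    have hle : ∀ y ∈ f '' S, y ≤ sSup (g '' S) + ε := by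
      rintro _ ⟨x, hx, rfl⟩
      linarith [(abs_le.1 (h x hx)).2, le_csSup hg (mem_image_of_mem g hx)]
    exact ⟨⟨_, hle⟩, csSup_le (hS.image f) hle⟩
  have h' : ∀ x ∈ S, |g x - f x| ≤ ε := fun x hx => abs_sub_comm (f x) (g x) ▸ h x hx
  by_cases hg : BddAbove (g '' S)
  · obtain ⟨hf, h₁⟩ := key f g h hg
    obtain ⟨-, h₂⟩ := key g f h' hf
    exact abs_le.2 ⟨by linarith, by linarith⟩
  · have hf : ¬ BddAbove (f '' S) := fun hf => hg (key g f h' hf).1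
    simpa [Real.sSup_of_not_bddAbove hf, Real.sSup_of_not_bddAbove hg] using hε

section Simplex

theorem exists_log_ip_exp_mem_Icc {d : ℕ} {x : Fin d → ℝ} (hx : x ∈ stdSimplex ℝ (Fin d))
    (y : Fin d → ℝ) :
    0 < ip x (fun i => Real.exp (y i)) ∧
      ∃ i j, Real.log (ip x (fun i => Real.exp (y i))) ∈ Icc (y i) (y j) := by
  have hne : Nonempty (Fin d) := by
    by_contra hne
    rw [not_nonempty_iff] at hne
    simpa using hx.2
  obtain ⟨i, hi⟩ := Finite.exists_min y
  obtain ⟨j, hj⟩ := Finite.exists_max y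
  have hlow : Real.exp (y i) ≤ ip x (fun i => Real.exp (y i)) := by
    calc Real.exp (y i) = ∑ k, x k * Real.exp (y i) := by rw [← Finset.sum_mul, hx.2, one_mul]
      _ ≤ _ := Finset.sum_le_sum fun k _ =>
        mul_le_mul_of_nonneg_left (Real.exp_le_exp.2 (hi k)) (hx.1 k)
  have hup : ip x (fun i => Real.exp (y i)) ≤ Real.exp (y j) := by
    calc _ ≤ ∑ k, x k * Real.exp (y j) := Finset.sum_le_sum fun k _ =>
          mul_le_mul_of_nonneg_left (Real.exp_le_exp.2 (hj k)) (hx.1 k)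
      _ = _ := by rw [← Finset.sum_mul, hx.2, one_mul]
  have hpos := (Real.exp_pos _).trans_le hlow
  exact ⟨hpos, i, j, (Real.le_log_iff_exp_le hpos).2 hlow, (Real.log_le_iff_le_exp hpos).2 hup⟩

theorem exp_mul_log_ip_le_sum {d : ℕ} {x : Fin d → ℝ} (hx : x ∈ stdSimplex ℝ (Fin d))
    (y : Fin d → ℝ) (δ : ℝ) :
    Real.exp (δ * Real.log (ip x (fun i => Real.exp (y i)))) ≤ ∑ i, Real.exp (δ * y i) := by
  obtain ⟨-, i, j, hi, hj⟩ := exists_log_ip_exp_mem_Icc hx y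
  obtain ⟨k, hk⟩ : ∃ k, δ * Real.log (ip x (fun i => Real.exp (y i))) ≤ δ * y k := by
    rcases le_total 0 δ with h | h
    · exact ⟨j, mul_le_mul_of_nonneg_left hj h⟩
    · exact ⟨i, mul_le_mul_of_nonpos_left hi h⟩
  exact (Real.exp_le_exp.2 hk).trans
    (Finset.single_le_sum (f := fun i => Real.exp (δ * y i)) (fun _ _ => (Real.exp_pos _).le)
      (Finset.mem_univ k))

theorem abs_log_ip_le_sum {d : ℕ} {x : Fin d → ℝ} (hx : x ∈ stdSimplex ℝ (Fin d))
    (y : Fin d → ℝ) : |Real.log (ip x (fun i => Real.exp (y i)))| ≤ ∑ i, |y i| := by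
  obtain ⟨-, i, j, hi, hj⟩ := exists_log_ip_exp_mem_Icc hx y
  have hle : ∀ k, |y k| ≤ ∑ i, |y i| := fun k =>
    Finset.single_le_sum (f := fun i => |y i|) (fun _ _ => abs_nonneg _) (Finset.mem_univ k)
  exact abs_le.2 ⟨by linarith [neg_abs_le (y i), hle i], by linarith [le_abs_self (y j), hle j]⟩

theorem Gmap_exp_mem_stdSimplex {d : ℕ} {x : Fin d → ℝ} (hx : x ∈ stdSimplex ℝ (Fin d))
    (y : Fin d → ℝ) : Gmap x (fun i => Real.exp (y i)) ∈ stdSimplex ℝ (Fin d) := by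
  have hpos := (exists_log_ip_exp_mem_Icc hx y).1
  refine ⟨fun i => div_nonneg (mul_nonneg (hx.1 i) (Real.exp_pos _).le) hpos.le, ?_⟩
  simp only [Gmap]
  rw [← Finset.sum_div]
  exact div_self hpos.ne'

theorem measurable_ip_exp {Ω : Type*} [MeasurableSpace Ω] {d : ℕ} (x : Fin d → ℝ)
    {r : Ω → Fin d → ℝ} (hr : Measurable r) :
    Measurable fun ω => ip x (fun i => Real.exp (r ω i)) := by
  unfold ip
  fun_prop

theorem measurable_Gmap_exp {Ω : Type*} [MeasurableSpace Ω] {d : ℕ} (x : Fin d → ℝ)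
    {r : Ω → Fin d → ℝ} (hr : Measurable r) :
    Measurable fun ω => Gmap x (fun i => Real.exp (r ω i)) := by
  have := measurable_ip_exp x hr
  unfold Gmap
  fun_prop

end Simplex

section Entropic

/-- Shifting by a constant changes `μ^δ` by at most that constant, also when `e^{δX}` is not
integrable. -/
theorem abs_entropic_add_const_sub_le {Ω : Type*} [MeasurableSpace Ω] (P : Measure Ω) (δ : ℝ)
    (X : Ω → ℝ) (a b : ℝ) :
    |entropic δ P (fun ω => X ω + a) - entropic δ P (fun ω => X ω + b)| ≤ |a - b| := by
  have h : ∀ c, ∫ ω, Real.exp (δ * (X ω + c)) ∂P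
      = (∫ ω, Real.exp (δ * X ω) ∂P) * Real.exp (δ * c) := by
    intro c
    rw [← integral_mul_const]
    simp only [mul_add, Real.exp_add]
  rcases eq_or_ne δ 0 with rfl | hδ
  · simp [entropic]
  simp only [entropic, h]
  rcases eq_or_ne (∫ ω, Real.exp (δ * X ω) ∂P) 0 with h0 | h0
  · simp [h0]
  · rw [Real.log_mul h0 (Real.exp_ne_zero _), Real.log_mul h0 (Real.exp_ne_zero _),
      Real.log_exp, Real.log_exp]
    apply le_of_eq
    congr 1
    field_simp
    ring

theorem entropic_add_const {Ω : Type*} [MeasurableSpace Ω] (P : Measure Ω)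
    [IsProbabilityMeasure P] {δ : ℝ} (hδ : δ ≠ 0) {X : Ω → ℝ}
    (hX : Integrable (fun ω => Real.exp (δ * X ω)) P) (c : ℝ) :
    entropic δ P (fun ω => X ω + c) = entropic δ P X + c := by
  simp only [entropic, mul_add, Real.exp_add]
  rw [integral_mul_const, Real.log_mul (integral_exp_pos hX).ne' (Real.exp_ne_zero _),
    Real.log_exp]
  field_simp

theorem entropic_mono {Ω : Type*} [MeasurableSpace Ω] (P : Measure Ω)
    [IsProbabilityMeasure P] {δ : ℝ} {X Y : Ω → ℝ}
    (hX : Integrable (fun ω => Real.exp (δ * X ω)) P)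
    (hY : Integrable (fun ω => Real.exp (δ * Y ω)) P) (h : ∀ ω, X ω ≤ Y ω) :
    entropic δ P X ≤ entropic δ P Y := by
  unfold entropic
  rcases le_total 0 δ with hδ | hδ
  · refine mul_le_mul_of_nonneg_left (Real.log_le_log (integral_exp_pos hX)
      (integral_mono hX hY fun ω => ?_)) (one_div_nonneg.2 hδ)
    exact Real.exp_le_exp.2 (mul_le_mul_of_nonneg_left (h ω) hδ)
  · refine mul_le_mul_of_nonpos_left (Real.log_le_log (integral_exp_pos hY)
      (integral_mono hY hX fun ω => ?_)) (one_div_nonpos.2 hδ)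
    exact Real.exp_le_exp.2 (mul_le_mul_of_nonpos_left (h ω) hδ)

theorem integrable_exp_mul_of_mem_Gam {Ω : Type*} [MeasurableSpace Ω] {P : Measure Ω}
    [IsProbabilityMeasure P] {γ δ : ℝ} (hδ : δ ∈ Gam γ) {X : Ω → ℝ} (hXm : Measurable X)
    (hX : Integrable (fun ω => Real.exp (γ * X ω)) P) :
    Integrable (fun ω => Real.exp (δ * X ω)) P := by
  refine ((integrable_const (1 : ℝ)).add hX).mono' (by fun_prop) (.of_forall fun ω => ?_)
  rw [Real.norm_of_nonneg (Real.exp_pos _).le]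
  have h : δ * X ω ≤ max (γ * X ω) 0 := by
    obtain ⟨⟨h₁, h₂⟩, -⟩ := hδ
    rcases le_total γ 0 with hγ | hγ
    · rw [min_eq_left hγ] at h₁
      rw [max_eq_right hγ] at h₂
      rcases le_total 0 (X ω) with hx | hx
      · exact le_max_of_le_right (mul_nonpos_of_nonpos_of_nonneg h₂ hx)
      · exact le_max_of_le_left (mul_le_mul_of_nonpos_right h₁ hx)
    · rw [min_eq_right hγ] at h₁
      rw [max_eq_left hγ] at h₂
      rcases le_total 0 (X ω) with hx | hx
      · exact le_max_of_le_left (mul_le_mul_of_nonneg_right h₂ hx)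
      · exact le_max_of_le_right (mul_nonpos_of_nonneg_of_nonpos h₁ hx)
  calc Real.exp (δ * X ω) ≤ Real.exp (max (γ * X ω) 0) := Real.exp_le_exp.2 h
    _ ≤ 1 + Real.exp (γ * X ω) := by
      rcases max_cases (γ * X ω) 0 with ⟨h, -⟩ | ⟨h, -⟩
      · rw [h]; linarith
      · rw [h, Real.exp_zero]; linarith [Real.exp_pos (γ * X ω)]

theorem mul_integral_le_log_integral_exp {Ω : Type*} [MeasurableSpace Ω] {P : Measure Ω}
    [IsProbabilityMeasure P] {δ : ℝ} {X : Ω → ℝ} (hXi : Integrable X P)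
    (hX : Integrable (fun ω => Real.exp (δ * X ω)) P) :
    δ * ∫ ω, X ω ∂P ≤ Real.log (∫ ω, Real.exp (δ * X ω) ∂P) := by
  rw [Real.le_log_iff_exp_le (integral_exp_pos hX), ← integral_const_mul]
  exact convexOn_exp.map_integral_le Real.continuous_exp.continuousOn isClosed_univ
    (.of_forall fun _ => mem_univ _) (hXi.const_mul δ) hX

/-- Lyapunov's inequality in logarithmic form. -/
theorem log_integral_exp_le_div_mul {Ω : Type*} [MeasurableSpace Ω] {P : Measure Ω}
    [IsProbabilityMeasure P] {γ δ : ℝ} (hδ : δ ∈ Gam γ) {X : Ω → ℝ} (hXm : Measurable X)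
    (hX : Integrable (fun ω => Real.exp (γ * X ω)) P) :
    Real.log (∫ ω, Real.exp (δ * X ω) ∂P)
      ≤ δ / γ * Real.log (∫ ω, Real.exp (γ * X ω) ∂P) := by
  have hXδ := integrable_exp_mul_of_mem_Gam hδ hXm hX
  obtain ⟨⟨h₁, h₂⟩, h₀⟩ := hδ
  have h₀ : δ ≠ 0 := h₀
  have hp : 1 ≤ γ / δ := by
    rcases le_total γ 0 with hγ | hγ
    · rw [min_eq_left hγ] at h₁
      rw [max_eq_right hγ] at h₂
      rwa [one_le_div_of_neg (lt_of_le_of_ne h₂ h₀)]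
    · rw [min_eq_right hγ] at h₁
      rw [max_eq_left hγ] at h₂
      rwa [one_le_div (lt_of_le_of_ne h₁ h₀.symm)]
  have hpow : ∀ ω, Real.exp (δ * X ω) ^ (γ / δ) = Real.exp (γ * X ω) := fun ω => by
    rw [← Real.exp_mul]
    congr 1
    field_simp
  have hjensen : (∫ ω, Real.exp (δ * X ω) ∂P) ^ (γ / δ) ≤ ∫ ω, Real.exp (γ * X ω) ∂P := by
    have := (convexOn_rpow hp).map_integral_le (μ := P) (f := fun ω => Real.exp (δ * X ω))
      (continuousOn_id.rpow_const fun _ _ => .inr (by linarith)) isClosed_Ici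
      (.of_forall fun _ => (Real.exp_pos _).le) hXδ
      (by simpa only [Function.comp_def, hpow] using hX)
    simpa only [hpow] using this
  have hpos := integral_exp_pos hXδ
  have hlog := Real.log_le_log (Real.rpow_pos_of_pos hpos _) hjensen
  rw [Real.log_rpow hpos] at hlog
  rw [← inv_div γ δ, inv_mul_eq_div, le_div_iff₀' (by linarith)]
  exact hlog

end Entropic

section EntropicBounds

theorem mem_Gam_iff {γ δ : ℝ} : δ ∈ Gam γ ↔ (0 < δ ∧ δ ≤ γ) ∨ (γ ≤ δ ∧ δ < 0) := by
  simp only [Gam, mem_sdiff, mem_Icc, mem_singleton_iff, min_le_iff, le_max_iff]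
  constructor
  · rintro ⟨⟨h₁, h₂⟩, h₀⟩
    rcases lt_or_gt_of_ne h₀ with h | h <;> grind
  · grind

theorem abs_le_of_mem_Gam {γ δ : ℝ} (hδ : δ ∈ Gam γ) : |δ| ≤ |γ| := by
  rcases mem_Gam_iff.1 hδ with ⟨h, h'⟩ | ⟨h', h⟩
  · rwa [abs_of_pos h, abs_of_pos (h.trans_le h')]
  · rw [abs_of_neg h, abs_of_neg (h'.trans_lt h)]
    linarith

theorem mul_exp_neg_mem_Gam {γ δ t : ℝ} (hδ : δ ∈ Gam γ) (ht : 0 ≤ t) :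
    δ * Real.exp (-t) ∈ Gam γ := by
  have h1 : Real.exp (-t) ≤ 1 := Real.exp_le_one_iff.2 (by linarith)
  have h0 := Real.exp_pos (-t)
  rw [mem_Gam_iff] at hδ ⊢
  rcases hδ with ⟨h, h'⟩ | ⟨h', h⟩
  · exact .inl ⟨by positivity, by nlinarith⟩
  · exact .inr ⟨by nlinarith, by nlinarith⟩

theorem integrable_exp_mul_log_ip {Ω : Type*} [MeasurableSpace Ω] {P : Measure Ω}
    {d : ℕ} {r : Ω → Fin d → ℝ} (hr : Measurable r) {δ : ℝ}
    (hint : ∀ i, Integrable (fun ω => Real.exp (δ * r ω i)) P)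
    {x : Fin d → ℝ} (hx : x ∈ stdSimplex ℝ (Fin d)) :
    Integrable (fun ω => Real.exp (δ * Real.log (ip x (fun i => Real.exp (r ω i))))) P := by
  have := measurable_ip_exp x hr
  refine (integrable_finsetSum Finset.univ fun i _ => hint i).mono'
    (Measurable.aestronglyMeasurable (by fun_prop))
    (.of_forall fun ω => ?_)
  rw [Real.norm_of_nonneg (Real.exp_pos _).le]
  exact exp_mul_log_ip_le_sum hx (r ω) δ

theorem entropic_log_ip_le {Ω : Type*} [MeasurableSpace Ω] {P : Measure Ω}
    [IsProbabilityMeasure P] {d : ℕ} {r : Ω → Fin d → ℝ} (hr : Measurable r) {γ δ : ℝ}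
    (hδ : δ ∈ Gam γ)
    (hexp : ∀ i, Integrable (fun ω => Real.exp (γ * r ω i)) P)
    (hint : ∀ i, Integrable (fun ω => r ω i) P) {a m : ℝ}
    (ha : ∀ i, entropic γ P (fun ω => r ω i) ≤ a) (hm : ∀ i, ∫ ω, |r ω i| ∂P ≤ m)
    {x : Fin d → ℝ} (hx : x ∈ stdSimplex ℝ (Fin d)) :
    entropic δ P (fun ω => Real.log (ip x (fun i => Real.exp (r ω i))))
      ≤ |a| + d * m + Real.log d / |γ| := by
  obtain ⟨i₀⟩ : Nonempty (Fin d) := by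
    by_contra hne
    rw [not_nonempty_iff] at hne
    simpa using hx.2
  have hd : (1 : ℝ) ≤ d := by exact_mod_cast i₀.pos
  have hm0 : 0 ≤ m := (integral_nonneg fun ω => abs_nonneg (r ω i₀)).trans (hm i₀)
  have hlogd : 0 ≤ Real.log d / |γ| := div_nonneg (Real.log_nonneg hd) (abs_nonneg γ)
  have hdm : 0 ≤ d * m := by positivity
  have hMm := measurable_ip_exp x hr
  have hM := integrable_exp_mul_log_ip hr hexp hx
  rcases mem_Gam_iff.1 hδ with ⟨h, h'⟩ | ⟨h', h⟩
  · have hγ : 0 < γ := h.trans_le h'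
    have hi : ∀ i, ∫ ω, Real.exp (γ * r ω i) ∂P ≤ Real.exp (γ * a) := fun i => by
      have := ha i
      rw [entropic, one_div, inv_mul_le_iff₀ hγ] at this
      exact (Real.log_le_iff_le_exp (integral_exp_pos (hexp i))).1 this
    have hsum : ∫ ω, Real.exp (γ * Real.log (ip x (fun i => Real.exp (r ω i)))) ∂P
        ≤ d * Real.exp (γ * a) := by
      calc _ ≤ ∫ ω, ∑ i, Real.exp (γ * r ω i) ∂P :=
            integral_mono hM (integrable_finsetSum _ fun i _ => hexp i)
              fun ω => exp_mul_log_ip_le_sum hx (r ω) γ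
        _ = ∑ i, ∫ ω, Real.exp (γ * r ω i) ∂P := integral_finsetSum _ fun i _ => hexp i
        _ ≤ ∑ _i : Fin d, Real.exp (γ * a) := Finset.sum_le_sum fun i _ => hi i
        _ = _ := by simp
    have hlog := Real.log_le_log (integral_exp_pos hM) hsum
    rw [Real.log_mul (by positivity) (Real.exp_ne_zero _), Real.log_exp] at hlog
    have hlyap := log_integral_exp_le_div_mul hδ
      (X := fun ω => Real.log (ip x (fun i => Real.exp (r ω i)))) (by fun_prop) hM
    have : entropic δ P (fun ω => Real.log (ip x (fun i => Real.exp (r ω i))))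
        ≤ Real.log d / γ + a := by
      rw [entropic, one_div, inv_mul_le_iff₀ h]
      calc _ ≤ _ := hlyap
        _ ≤ δ / γ * (Real.log d + γ * a) := mul_le_mul_of_nonneg_left hlog (by positivity)
        _ = _ := by field_simp
    rw [abs_of_pos hγ]
    linarith [le_abs_self a]
  · have hMδ := integrable_exp_mul_of_mem_Gam hδ
      (X := fun ω => Real.log (ip x (fun i => Real.exp (r ω i)))) (by fun_prop) hM
    have hsumint : Integrable (fun ω => ∑ i, |r ω i|) P :=
      integrable_finsetSum _ fun i _ => (hint i).abs
    have hMi : Integrable (fun ω => Real.log (ip x (fun i => Real.exp (r ω i)))) P :=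
      hsumint.mono' (Measurable.aestronglyMeasurable (by fun_prop))
        (.of_forall fun ω => abs_log_ip_le_sum hx (r ω))
    have hEM : ∫ ω, Real.log (ip x (fun i => Real.exp (r ω i))) ∂P ≤ d * m := by
      calc _ ≤ ∫ ω, ∑ i, |r ω i| ∂P := integral_mono hMi hsumint
            fun ω => (le_abs_self _).trans (abs_log_ip_le_sum hx (r ω))
        _ = ∑ i, ∫ ω, |r ω i| ∂P := integral_finsetSum _ fun i _ => (hint i).abs
        _ ≤ ∑ _i : Fin d, m := Finset.sum_le_sum fun i _ => hm i
        _ = _ := by simp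
    have hjensen := mul_integral_le_log_integral_exp hMi hMδ
    have : entropic δ P (fun ω => Real.log (ip x (fun i => Real.exp (r ω i))))
        ≤ ∫ ω, Real.log (ip x (fun i => Real.exp (r ω i))) ∂P := by
      rw [entropic, one_div_mul_eq_div, div_le_iff_of_neg h, mul_comm]
      exact hjensen
    linarith [abs_nonneg a]

theorem le_entropic_apply {Ω : Type*} [MeasurableSpace Ω] {P : Measure Ω}
    [IsProbabilityMeasure P] {d : ℕ} {r : Ω → Fin d → ℝ} (hr : Measurable r) {γ δ : ℝ}
    (hδ : δ ∈ Gam γ) {i : Fin d}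
    (hexp : Integrable (fun ω => Real.exp (γ * r ω i)) P)
    (hint : Integrable (fun ω => r ω i) P) {a m : ℝ}
    (ha : a ≤ entropic γ P (fun ω => r ω i)) (hm : ∫ ω, |r ω i| ∂P ≤ m) :
    -|a| - d * m ≤ entropic δ P (fun ω => r ω i) := by
  have hd : (1 : ℝ) ≤ d := by exact_mod_cast i.pos
  have hm0 : 0 ≤ m := (integral_nonneg fun ω => abs_nonneg (r ω i)).trans hm
  have hmd : m ≤ d * m := le_mul_of_one_le_left hm0 hd
  rcases mem_Gam_iff.1 hδ with ⟨h, h'⟩ | ⟨h', h⟩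
  · have hjensen := mul_integral_le_log_integral_exp hint
      (integrable_exp_mul_of_mem_Gam hδ (by fun_prop) hexp)
    have : ∫ ω, r ω i ∂P ≤ entropic δ P (fun ω => r ω i) := by
      rw [entropic, one_div_mul_eq_div, le_div_iff₀ h, mul_comm]
      exact hjensen
    have habs : |∫ ω, r ω i ∂P| ≤ ∫ ω, |r ω i| ∂P := abs_integral_le_integral_abs
    linarith [neg_abs_le (∫ ω, r ω i ∂P), abs_nonneg a]
  · have hγ : γ < 0 := h'.trans_lt h
    have hlyap := log_integral_exp_le_div_mul hδ (X := fun ω => r ω i) (by fun_prop) hexp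
    have : entropic γ P (fun ω => r ω i) ≤ entropic δ P (fun ω => r ω i) := by
      rw [entropic, entropic, one_div_mul_eq_div, one_div_mul_eq_div, le_div_iff_of_neg h]
      calc _ ≤ _ := hlyap
        _ = _ := by ring
    linarith [neg_abs_le a]

end EntropicBounds

section Bellman

theorem abs_TOp_sub_TOp_le {d : ℕ} {Ω : Type*} [MeasurableSpace Ω] (P : Measure Ω)
    {s : (Fin d → ℝ) → (Fin d → ℝ) → ℝ} (r : Ω → Fin d → ℝ) (α : ℝ)
    (v : (Fin d → ℝ) → ℝ → ℝ) (δ : ℝ) {x y : Fin d → ℝ} {ε : ℝ} (hε : 0 ≤ ε)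
    (h : ∀ z ∈ stdSimplex ℝ (Fin d), |Real.log (s x z) - Real.log (s y z)| ≤ ε) :
    |TOp P s r α v x δ - TOp P s r α v y δ| ≤ |δ| * ε := by
  unfold TOp
  rw [← mul_sub, abs_mul]
  refine mul_le_mul_of_nonneg_left
    (abs_sSup_image_sub_sSup_image_le hε fun z hz => ?_) (abs_nonneg δ)
  have := abs_entropic_add_const_sub_le P δ
    (fun ω => Real.log (ip z (fun i => Real.exp (r ω i))) +
      δ⁻¹ * v (Gmap z (fun i => Real.exp (r ω i))) (δ * Real.exp (-α)))
    (Real.log (s x z)) (Real.log (s y z))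
  simp only [add_right_comm _ (δ⁻¹ * _) _] at this
  exact this.trans (h z hz)

/-- The Bellman operator maps any function to one that is continuous in the portfolio. -/
theorem continuousOn_TOp {d : ℕ} {Ω : Type*} [MeasurableSpace Ω] (P : Measure Ω)
    {s : (Fin d → ℝ) → (Fin d → ℝ) → ℝ}
    (hs0 : ∀ x ∈ stdSimplex ℝ (Fin d), ∀ y ∈ stdSimplex ℝ (Fin d), 0 < s x y)
    (hscont : ContinuousOn (fun p : (Fin d → ℝ) × (Fin d → ℝ) => s p.1 p.2)
      (stdSimplex ℝ (Fin d) ×ˢ stdSimplex ℝ (Fin d)))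
    (r : Ω → Fin d → ℝ) (α : ℝ) (v : (Fin d → ℝ) → ℝ → ℝ) (δ : ℝ) :
    ContinuousOn (fun x => TOp P s r α v x δ) (stdSimplex ℝ (Fin d)) := by
  have hlog : ContinuousOn (fun p : (Fin d → ℝ) × (Fin d → ℝ) => Real.log (s p.1 p.2))
      (stdSimplex ℝ (Fin d) ×ˢ stdSimplex ℝ (Fin d)) :=
    hscont.log fun p hp => (hs0 p.1 hp.1 p.2 hp.2).ne'
  have hunif := ((isCompact_stdSimplex ℝ (Fin d)).prod
    (isCompact_stdSimplex ℝ (Fin d))).uniformContinuousOn_of_continuous hlog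
  rw [Metric.uniformContinuousOn_iff] at hunif
  rw [Metric.continuousOn_iff]
  intro y hy ε hε
  have hη : 0 < ε / (|δ| + 1) := by positivity
  obtain ⟨ρ, hρ, h⟩ := hunif _ hη
  refine ⟨ρ, hρ, fun x hx hxy => ?_⟩
  rw [Real.dist_eq]
  calc |TOp P s r α v x δ - TOp P s r α v y δ| ≤ |δ| * (ε / (|δ| + 1)) :=
        abs_TOp_sub_TOp_le P r α v δ hη.le fun z hz => by
          have := h (x, z) ⟨hx, hz⟩ (y, z) ⟨hy, hz⟩ (by simpa [Prod.dist_eq] using hxy)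
          rw [Real.dist_eq] at this
          exact this.le
    _ < (|δ| + 1) * (ε / (|δ| + 1)) := by gcongr; linarith
    _ = ε := by field_simp

theorem abs_log_le_abs_log_of_mem_Icc {a t : ℝ} (ha : 0 < a) (ht : t ∈ Icc a 1) :
    |Real.log t| ≤ |Real.log a| := by
  rw [abs_of_nonpos (Real.log_nonpos (ha.le.trans ht.1) ht.2),
    abs_of_nonpos (Real.log_nonpos ha.le (ht.1.trans ht.2))]
  linarith [Real.log_le_log ha ht.1]

/-- Changing the risk parameter of a Bellman solution by one discounting step costs at most
`|δ|` times a bound built from the capital decay and the one-step entropic utilities. -/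
theorem abs_sub_discount_le_of_eq_TOp {d : ℕ} {Ω : Type*} [MeasurableSpace Ω] {P : Measure Ω}
    [IsProbabilityMeasure P] {st : ℝ} (hst : st ∈ Ioo (0 : ℝ) 1)
    {s : (Fin d → ℝ) → (Fin d → ℝ) → ℝ}
    (hs : ∀ x ∈ stdSimplex ℝ (Fin d), ∀ y ∈ stdSimplex ℝ (Fin d), s x y ∈ Icc st 1)
    (hscont : ContinuousOn (fun p : (Fin d → ℝ) × (Fin d → ℝ) => s p.1 p.2)
      (stdSimplex ℝ (Fin d) ×ˢ stdSimplex ℝ (Fin d)))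
    {r : Ω → Fin d → ℝ} (hr : Measurable r) {γ δ α : ℝ} (hδ : δ ∈ Gam γ) (hα : 0 ≤ α)
    (hexp : ∀ i, Integrable (fun ω => Real.exp (γ * r ω i)) P)
    {v : (Fin d → ℝ) → ℝ → ℝ}
    (hv : ∀ x ∈ stdSimplex ℝ (Fin d), ∀ δ ∈ Gam γ, v x δ = TOp P s r α v x δ)
    {A B : ℝ}
    (hup : ∀ x ∈ stdSimplex ℝ (Fin d),
      entropic δ P (fun ω => Real.log (ip x (fun i => Real.exp (r ω i)))) ≤ A)
    {i : Fin d} (hlow : -B ≤ entropic δ P (fun ω => r ω i))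
    {p : Fin d → ℝ} (hp : p ∈ stdSimplex ℝ (Fin d)) :
    |v p δ - v p (δ * Real.exp (-α))| ≤ |δ| * (|Real.log st| + max A (B + |Real.log st|)) := by
  have hδ0 : δ ≠ 0 := hδ.2
  have hδα := mul_exp_neg_mem_Gam hδ hα
  set δ' := δ * Real.exp (-α) with hδ'
  set L := |Real.log st| with hL
  have hlogs : ∀ x ∈ stdSimplex ℝ (Fin d), ∀ y ∈ stdSimplex ℝ (Fin d),
      -L ≤ Real.log (s x y) ∧ Real.log (s x y) ≤ 0 := fun x hx y hy =>
    ⟨(abs_le.1 (abs_log_le_abs_log_of_mem_Icc hst.1 (hs x hx y hy))).1,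
      Real.log_nonpos (hst.1.le.trans (hs x hx y hy).1) (hs x hx y hy).2⟩
  have hosc : ∀ x ∈ stdSimplex ℝ (Fin d), |δ⁻¹ * v x δ' - δ⁻¹ * v p δ'| ≤ L := by
    intro x hx
    have h1 : |v x δ' - v p δ'| ≤ |δ'| * L := by
      rw [hv x hx _ hδα, hv p hp _ hδα]
      refine abs_TOp_sub_TOp_le P r α v _ (abs_nonneg _) fun z hz => ?_
      have := hlogs x hx z hz
      have := hlogs p hp z hz
      exact abs_le.2 ⟨by linarith, by linarith⟩
    have h2 : |δ'| ≤ |δ| := abs_le_of_mem_Gam (mul_exp_neg_mem_Gam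
      (mem_Gam_iff.2 ((lt_or_gt_of_ne hδ0).symm.imp (⟨·, le_rfl⟩) (⟨le_rfl, ·⟩))) hα)
    rw [← mul_sub, abs_mul, abs_inv, inv_mul_le_iff₀ (abs_pos.2 hδ0)]
    exact h1.trans (mul_le_mul_of_nonneg_right h2 (abs_nonneg _))
  have hvmeas : ∀ z ∈ stdSimplex ℝ (Fin d),
      Measurable fun ω => v (Gmap z (fun i => Real.exp (r ω i))) δ' := by
    intro z hz
    have hcont : ContinuousOn (fun x => v x δ') (stdSimplex ℝ (Fin d)) :=
      (continuousOn_TOp P (fun x hx y hy => hst.1.trans_le (hs x hx y hy).1) hscont r α v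
        δ').congr fun x hx => hv x hx _ hδα
    exact (continuousOn_iff_continuous_domRestrict.1 hcont).measurable.comp
      ((measurable_Gmap_exp z hr).subtype_mk (h := fun ω => Gmap_exp_mem_stdSimplex hz (r ω)))
  have hMint : ∀ z ∈ stdSimplex ℝ (Fin d), Integrable
      (fun ω => Real.exp (δ * Real.log (ip z (fun i => Real.exp (r ω i))))) P := fun z hz =>
    integrable_exp_mul_log_ip hr
      (fun i => integrable_exp_mul_of_mem_Gam hδ (by fun_prop) (hexp i)) hz
  have hMcint : ∀ z ∈ stdSimplex ℝ (Fin d), ∀ c, Integrable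
      (fun ω => Real.exp (δ * (Real.log (ip z (fun i => Real.exp (r ω i))) + c))) P := by
    intro z hz c
    simp only [mul_add, Real.exp_add]
    exact (hMint z hz).mul_const _
  set F : (Fin d → ℝ) → Ω → ℝ := fun z ω =>
    Real.log (ip z (fun i => Real.exp (r ω i))) + Real.log (s p z) +
      δ⁻¹ * v (Gmap z (fun i => Real.exp (r ω i))) δ' with hF
  set V := δ⁻¹ * v p δ' with hV
  have hFup : ∀ z ∈ stdSimplex ℝ (Fin d), ∀ ω,
      F z ω ≤ Real.log (ip z (fun i => Real.exp (r ω i))) + (V + L) := fun z hz ω => by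
    have := (abs_le.1 (hosc _ (Gmap_exp_mem_stdSimplex hz (r ω)))).2
    have := (hlogs p hp z hz).2
    simp only [hF]
    linarith
  have hFlow : ∀ z ∈ stdSimplex ℝ (Fin d), ∀ ω,
      Real.log (ip z (fun i => Real.exp (r ω i))) + (V - 2 * L) ≤ F z ω := fun z hz ω => by
    have := (abs_le.1 (hosc _ (Gmap_exp_mem_stdSimplex hz (r ω)))).1
    have := (hlogs p hp z hz).1
    simp only [hF]
    linarith
  have hFint : ∀ z ∈ stdSimplex ℝ (Fin d),
      Integrable (fun ω => Real.exp (δ * F z ω)) P := by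
    intro z hz
    have hm1 := hvmeas z hz
    have hm2 := measurable_ip_exp z hr
    refine ((hMcint z hz (V + L)).add (hMcint z hz (V - 2 * L))).mono'
      ((((hm2.log.add_const _).add
      (hm1.const_mul _)).const_mul δ).exp.aestronglyMeasurable)
      (.of_forall fun ω => ?_)
    rw [Real.norm_of_nonneg (Real.exp_pos _).le, Pi.add_apply]
    rcases le_total 0 δ with h | h
    · exact le_add_of_le_of_nonneg
        (Real.exp_le_exp.2 (mul_le_mul_of_nonneg_left (hFup z hz ω) h)) (Real.exp_pos _).le
    · exact le_add_of_nonneg_of_le (Real.exp_pos _).le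
        (Real.exp_le_exp.2 (mul_le_mul_of_nonpos_left (hFlow z hz ω) h))
  have hEup : ∀ y ∈ (fun z => entropic δ P (F z)) '' stdSimplex ℝ (Fin d),
      y ≤ A + (V + L) := by
    rintro _ ⟨z, hz, rfl⟩
    have := entropic_mono P (hFint z hz) (hMcint z hz (V + L)) (hFup z hz)
    rw [entropic_add_const P hδ0 (hMint z hz)] at this
    exact this.trans (by linarith [hup z hz])
  have hElow : -B + (V - 2 * L) ≤ entropic δ P (F (Pi.single i 1)) := by
    have hz := single_mem_stdSimplex ℝ i
    have := entropic_mono P (hMcint _ hz (V - 2 * L)) (hFint _ hz) (hFlow _ hz)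
    rw [entropic_add_const P hδ0 (hMint _ hz)] at this
    have hsingle : ∀ ω, Real.log (ip (Pi.single i 1) (fun i => Real.exp (r ω i))) = r ω i :=
      fun ω => by simp [ip, Pi.single_apply]
    simp only [hsingle] at this
    linarith
  have hS1 : sSup ((fun z => entropic δ P (F z)) '' stdSimplex ℝ (Fin d)) ≤ A + (V + L) :=
    csSup_le ⟨_, mem_image_of_mem _ hp⟩ hEup
  have hS2 := hElow.trans (le_csSup ⟨_, hEup⟩ (mem_image_of_mem _ (single_mem_stdSimplex ℝ i)))
  have hL0 : 0 ≤ L := abs_nonneg _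
  have hvp : v p δ - v p δ'
      = δ * (sSup ((fun z => entropic δ P (F z)) '' stdSimplex ℝ (Fin d)) - V) := by
    rw [hv p hp δ hδ, mul_sub, hV, mul_inv_cancel_left₀ hδ0]
    rfl
  rw [hvp, abs_mul]
  exact mul_le_mul_of_nonneg_left (abs_le.2 ⟨by linarith [le_max_right A (B + L)],
    by linarith [le_max_left A (B + L)]⟩) (abs_nonneg _)

end Bellman

/-- Lemma `lm:lambda.bound`: under (A.1), with `π̂ ∈ S` fixed and, for
each `α ∈ (0,1)`, a bounded solution `v_α` of the discounted Bellman equation, the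
quantities `λ_α⁽ⁿ⁾ = v_α(π̂, γe^{-αn}) − v_α(π̂, γe^{-α(n+1)})` are uniformly bounded:
`sup_{α,n} |λ_α⁽ⁿ⁾| < ∞`, with `|λ_α⁽ⁿ⁾| ≤ |γ|(|ln s̃| + max(|z⁻|, |z⁺|))`. -/
theorem lambda_uniformly_bounded {d : ℕ} (hd : 0 < d) {Ω : Type*} [MeasurableSpace Ω]
    (P : Measure Ω) [IsProbabilityMeasure P]
    (st : ℝ) (hst : st ∈ Ioo (0 : ℝ) 1)
    (s : (Fin d → ℝ) → (Fin d → ℝ) → ℝ)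
    (hs : ∀ x ∈ stdSimplex ℝ (Fin d), ∀ y ∈ stdSimplex ℝ (Fin d), s x y ∈ Icc st 1)
    (hscont : ContinuousOn (fun p : (Fin d → ℝ) × (Fin d → ℝ) => s p.1 p.2)
      (stdSimplex ℝ (Fin d) ×ˢ stdSimplex ℝ (Fin d)))
    (γ : ℝ) (hγ : γ ≠ 0) (r : Ω → Fin d → ℝ) (hrm : Measurable r)
    (hA1exp : ∀ i, Integrable (fun ω => Real.exp (γ * r ω i)) P)
    (hA1int : ∀ i, Integrable (fun ω => r ω i) P)
    (zminus zplus : ℝ)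
    (hzminus : zminus =
      -|Finset.univ.inf' (Finset.univ_nonempty_iff.mpr ⟨⟨0, hd⟩⟩)
          (fun i => entropic γ P (fun ω => r ω i))| -
        d * Finset.univ.sup' (Finset.univ_nonempty_iff.mpr ⟨⟨0, hd⟩⟩)
          (fun i => ∫ ω, |r ω i| ∂P) -
        Real.log d / |γ| + Real.log st)
    (hzplus : zplus =
      |Finset.univ.sup' (Finset.univ_nonempty_iff.mpr ⟨⟨0, hd⟩⟩)
          (fun i => entropic γ P (fun ω => r ω i))| +
        d * Finset.univ.sup' (Finset.univ_nonempty_iff.mpr ⟨⟨0, hd⟩⟩)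
          (fun i => ∫ ω, |r ω i| ∂P) +
        Real.log d / |γ|)
    (pihat : Fin d → ℝ) (hpihat : pihat ∈ stdSimplex ℝ (Fin d))
    (vfam : ℝ → (Fin d → ℝ) → ℝ → ℝ)
    (hvb : ∀ α ∈ Ioo (0 : ℝ) 1,
      ∃ C : ℝ, ∀ π ∈ stdSimplex ℝ (Fin d), ∀ δ ∈ Gam γ, |vfam α π δ| ≤ C)
    (hvbell : ∀ α ∈ Ioo (0 : ℝ) 1, ∀ π ∈ stdSimplex ℝ (Fin d), ∀ δ ∈ Gam γ,
      vfam α π δ = TOp P s r α (vfam α) π δ) :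
    (∃ C : ℝ, ∀ α ∈ Ioo (0 : ℝ) 1, ∀ n : ℕ,
      |vfam α pihat (γ * Real.exp (-α * n)) -
        vfam α pihat (γ * Real.exp (-α * (n + 1)))| ≤ C) ∧
    ∀ α ∈ Ioo (0 : ℝ) 1, ∀ n : ℕ,
      |vfam α pihat (γ * Real.exp (-α * n)) -
          vfam α pihat (γ * Real.exp (-α * (n + 1)))| ≤
        |γ| * (|Real.log st| + max |zminus| |zplus|) := by

  suffices h : ∀ α ∈ Ioo (0 : ℝ) 1, ∀ n : ℕ,
      |vfam α pihat (γ * Real.exp (-α * n)) -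
          vfam α pihat (γ * Real.exp (-α * (n + 1)))| ≤
        |γ| * (|Real.log st| + max |zminus| |zplus|) from ⟨⟨_, h⟩, h⟩
  intro α hα n
  have hγmem : γ ∈ Gam γ :=
    mem_Gam_iff.2 ((lt_or_gt_of_ne hγ).symm.imp (⟨·, le_rfl⟩) (⟨le_rfl, ·⟩))
  have hδ : γ * Real.exp (-α * n) ∈ Gam γ := by
    rw [neg_mul]
    exact mul_exp_neg_mem_Gam hγmem (mul_nonneg hα.1.le n.cast_nonneg)
  have hstep : γ * Real.exp (-α * (n + 1)) = γ * Real.exp (-α * n) * Real.exp (-α) := by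
    rw [mul_assoc, ← Real.exp_add]
    ring_nf
  have hm : ∀ i, ∫ ω, |r ω i| ∂P ≤ Finset.univ.sup'
      (Finset.univ_nonempty_iff.mpr ⟨⟨0, hd⟩⟩) (fun i => ∫ ω, |r ω i| ∂P) := fun i =>
    Finset.le_sup' (fun i => ∫ ω, |r ω i| ∂P) (Finset.mem_univ i)
  have hup : ∀ x ∈ stdSimplex ℝ (Fin d), entropic (γ * Real.exp (-α * n)) P
      (fun ω => Real.log (ip x (fun i => Real.exp (r ω i)))) ≤ zplus := fun x hx =>
    hzplus ▸ entropic_log_ip_le hrm hδ hA1exp hA1int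
      (fun i => Finset.le_sup' (fun i => entropic γ P (fun ω => r ω i)) (Finset.mem_univ i))
      hm hx
  have hlow := le_entropic_apply hrm hδ (hA1exp ⟨0, hd⟩) (hA1int _)
    (Finset.inf'_le (fun i => entropic γ P (fun ω => r ω i)) (Finset.mem_univ _)) (hm _)
  rw [← neg_add'] at hlow
  have hdiff := abs_sub_discount_le_of_eq_TOp hst hs hscont hrm hδ hα.1.le hA1exp
    (hvbell α hα) hup hlow hpihat
  rw [hstep]
  have hlogd : 0 ≤ Real.log d / |γ| :=
    div_nonneg (Real.log_nonneg (by exact_mod_cast hd)) (abs_nonneg γ)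
  have hlogst : |Real.log st| = -Real.log st :=
    abs_of_nonpos (Real.log_nonpos hst.1.le hst.2.le)
  refine hdiff.trans (mul_le_mul (abs_le_of_mem_Gam hδ)
    (add_le_add_right (max_le (le_max_of_le_right (le_abs_self _)) (le_max_of_le_left ?_)) _)
    (nonneg_of_mul_nonneg_right ((abs_nonneg _).trans hdiff) (abs_pos.2 hδ.2)) (abs_nonneg γ))
  refine le_trans ?_ (neg_le_abs zminus)
  rw [hzminus, hlogst]
  linarith
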